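/- arXiv:0907.3375 — 5 statements merged into one kernel-verified Lean document; each statement's English description precedes it below -/
import Mathlib

section
/- Let p be a prime, k a perfect field of characteristic p, V a finite-dimensional k-vector space, and f : V → V a Frobenius-semilinear endomorphism. Set V_nilp = {v ∈ V : f^[n](v) = 0 for some natural number n} and V_ss = ⋂_{n ∈ ℕ} f^[n](V). Then: (1) V_nilp and V_ss are k-linear subspaces of V; (2) f maps V_ss bijectively onto V_ss; (3) there exists N with f^[N](v) = 0 for all v ∈ V_nilp; and (4) V is the internal direct sum of V_ss and V_nilp, i.e. V_ss ∩ V_nilp = {0} and V_ss + V_nilp = V. -/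
section PowSemilinear

variable {p : ℕ} {k V : Type*} [Field k] [AddCommGroup V] [Module k V] {f : V → V}

theorem iterate_smul_of_pow_semilinear (hsmul : ∀ (a : k) (v : V), f (a • v) = a ^ p • f v)
    (n : ℕ) (a : k) (v : V) : f^[n] (a • v) = a ^ p ^ n • f^[n] v := by
  induction n generalizing a v with
  | zero => simp
  | succ n ih => rw [Function.iterate_succ_apply, hsmul, ih, ← pow_mul, ← pow_succ',
      Function.iterate_succ_apply]

/-- The kernel of the `n`-th iterate of an additive map with `f (a • v) = a ^ p • f v`. -/
def powSemilinearKer (F : V →+ V)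
    (hsmul : ∀ (a : k) (v : V), F (a • v) = a ^ p • F v) : ℕ →o Submodule k V where
  toFun n :=
    { carrier := {v | F^[n] v = 0}
      zero_mem' := iterate_map_zero F n
      add_mem' := fun {v w} (hv : F^[n] v = 0) (hw : F^[n] w = 0) ↦ by
        simp [iterate_map_add, hv, hw]
      smul_mem' := fun a v (hv : F^[n] v = 0) ↦ by
        simp [iterate_smul_of_pow_semilinear hsmul, hv] }
  monotone' := monotone_nat_of_le_succ fun n v (hv : F^[n] v = 0) ↦ by
    change F^[n + 1] v = 0
    rw [Function.iterate_succ_apply', hv, map_zero]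

/-- The range of the `n`-th iterate of an additive map with `f (a • v) = a ^ p • f v`, over a field
in which every element is a `p`-th power. -/
def powSemilinearRange (F : V →+ V) (hperf : ∀ a : k, ∃ b : k, b ^ p = a)
    (hsmul : ∀ (a : k) (v : V), F (a • v) = a ^ p • F v) : ℕ →o (Submodule k V)ᵒᵈ where
  toFun n := OrderDual.toDual
    { carrier := Set.range F^[n]
      zero_mem' := ⟨0, iterate_map_zero F n⟩
      add_mem' := by
        rintro _ _ ⟨v, rfl⟩ ⟨w, rfl⟩
        exact ⟨v + w, iterate_map_add F n v w⟩
      smul_mem' := by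
        rintro a _ ⟨v, rfl⟩
        have hroot : ∃ b : k, b ^ p ^ n = a := by
          have h : Function.Surjective (fun b : k ↦ b ^ p)^[n] :=
            Function.Surjective.iterate hperf n
          simpa only [pow_iterate] using h a
        obtain ⟨b, rfl⟩ := hroot
        exact ⟨b • v, iterate_smul_of_pow_semilinear hsmul n b v⟩ }
  monotone' := monotone_nat_of_le_succ fun n ↦ by
    rintro _ ⟨v, rfl⟩
    exact ⟨F v, (Function.iterate_succ_apply F n v).symm⟩

end PowSemilinear


/-- Fitting decomposition for a Frobenius-semilinear endomorphism `f`
of a finite-dimensional vector space over a perfect field of characteristic `p`: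
`V_nilp` and `V_ss` are subspaces, `f` maps `V_ss` bijectively onto itself, some
iterate of `f` kills `V_nilp`, and `V` is the internal direct sum of `V_ss` and
`V_nilp`. -/
theorem stratified_stmt2 (p : ℕ) (hp : p.Prime) (k : Type*) [Field k] (hchar : CharP k p)
    (hperf : ∀ a : k, ∃ b : k, b ^ p = a)
    (V : Type*) [AddCommGroup V] [Module k V] [FiniteDimensional k V]
    (f : V → V) (hadd : ∀ v w : V, f (v + w) = f v + f w)
    (hsmul : ∀ (a : k) (v : V), f (a • v) = a ^ p • f v) :
    (∃ S : Submodule k V, (S : Set V) = {v : V | ∃ n : ℕ, f^[n] v = 0}) ∧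
    (∃ T : Submodule k V, (T : Set V) = ⋂ n : ℕ, Set.range f^[n]) ∧
    Set.BijOn f (⋂ n : ℕ, Set.range f^[n]) (⋂ n : ℕ, Set.range f^[n]) ∧
    (∃ N : ℕ, ∀ v ∈ {v : V | ∃ n : ℕ, f^[n] v = 0}, f^[N] v = 0) ∧
    (⋂ n : ℕ, Set.range f^[n]) ∩ {v : V | ∃ n : ℕ, f^[n] v = 0} = {0} ∧
    (∀ v : V, ∃ s ∈ ⋂ n : ℕ, Set.range f^[n],
      ∃ w ∈ {v : V | ∃ n : ℕ, f^[n] v = 0}, v = s + w) := by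
  obtain ⟨F, rfl⟩ : ∃ F : V →+ V, ⇑F = f := ⟨AddMonoidHom.mk' f hadd, rfl⟩
  let K := powSemilinearKer F hsmul
  let R := powSemilinearRange F hperf hsmul
  obtain ⟨a, ha⟩ := monotone_stabilizes_iff_noetherian.mpr (inferInstance : IsNoetherian k V) K
  obtain ⟨b, hb⟩ := IsArtinian.monotone_stabilizes R
  have hker {n : ℕ} {v : V} (hv : F^[n] v = 0) : F^[a] v = 0 := by
    have h : v ∈ K (max a n) := K.monotone (le_max_right a n) hv
    rwa [← ha _ (le_max_left a n)] at h
  have hran {v : V} (hv : v ∈ Set.range F^[b]) (n : ℕ) : v ∈ Set.range F^[n] := by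
    have h : v ∈ OrderDual.ofDual (R (max b n)) := by
      rw [← hb _ (le_max_left b n)]
      exact hv
    exact R.monotone (le_max_right b n) h
  have hss : ⋂ n : ℕ, Set.range F^[n] = Set.range F^[b] :=
    (Set.iInter_subset _ b).antisymm fun v hv ↦ Set.mem_iInter.2 (hran hv)
  have hdisj {v : V} (hv : v ∈ Set.range F^[b]) {n : ℕ} (hn : F^[n] v = 0) : v = 0 := by
    obtain ⟨u, rfl⟩ := hran hv a
    rw [← Function.iterate_add_apply] at hn
    exact hker hn
  rw [hss]
  refine ⟨⟨K a, Set.ext fun v ↦ ⟨fun h ↦ ⟨a, h⟩, fun ⟨_, h⟩ ↦ hker h⟩⟩,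
    ⟨OrderDual.ofDual (R b), rfl⟩, ⟨?_, ?_, ?_⟩, ⟨a, fun v ⟨_, h⟩ ↦ hker h⟩, ?_, fun v ↦ ?_⟩
  · rintro _ ⟨u, rfl⟩
    exact ⟨F u, (Function.Commute.refl F).iterate_left b u⟩
  · intro x hx y hy hxy
    refine sub_eq_zero.1 (hdisj (n := 1) ((OrderDual.ofDual (R b)).sub_mem hx hy) ?_)
    rw [Function.iterate_one, map_sub, hxy, sub_self]
  · intro x hx
    obtain ⟨u, rfl⟩ := hran hx (b + 1)
    exact ⟨F^[b] u, ⟨u, rfl⟩, (Function.iterate_succ_apply' F b u).symm⟩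
  · refine Set.Subset.antisymm (fun v ⟨hv, _, hn⟩ ↦ hdisj hv hn) ?_
    rintro _ rfl
    exact ⟨⟨0, iterate_map_zero F b⟩, 0, rfl⟩
  · obtain ⟨u, hu⟩ := hran ⟨v, rfl⟩ (b + b)
    refine ⟨F^[b] u, ⟨u, rfl⟩, v - F^[b] u, ⟨b, ?_⟩, (add_sub_cancel _ _).symm⟩
    rw [iterate_map_sub, ← Function.iterate_add_apply, hu, sub_self]
end

section
/- Let p be a prime, k an algebraically closed field of characteristic p, V a finite-dimensional k-vector space, and f : V → V a bijective Frobenius-semilinear endomorphism. Then the fixed-point set V^f = {v ∈ V : f(v) = v} is an 𝔽_p-linear subspace of V (where V is viewed as an 𝔽_p-vector space), the k-linear span of V^f is all of V, and V^f is finite of cardinality p^{dim_k V}. -/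
open Polynomial in
/-- The polynomials in `y` giving the coefficients of a fixed vector `∑ xᵢ fⁱ v`, where
`f ^ n v = ∑ aᵢ fⁱ v` and `y` is the last coefficient. -/
noncomputable def langPoly {k : Type*} [Field k] (p : ℕ) (a : ℕ → k) : ℕ → k[X]
  | 0 => C (a 0) * X ^ p
  | i + 1 => langPoly p a i ^ p + C (a (i + 1)) * X ^ p

open Polynomial in
theorem X_pow_dvd_langPoly {k : Type*} [Field k] {p : ℕ} (hp : p.Prime) (a : ℕ → k) (i : ℕ) :
    X ^ p ∣ langPoly p a i := by
  induction i with
  | zero => exact Dvd.intro_left _ rfl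
  | succ i ih =>
    exact dvd_add (ih.trans (dvd_pow_self _ hp.ne_zero)) (Dvd.intro_left _ rfl)

open Polynomial in
theorem eq_zero_of_langPoly_eq_zero {k : Type*} [Field k] {p : ℕ} (hp : p.Prime) (a : ℕ → k)
    (i : ℕ) (h : langPoly p a i = 0) : ∀ j ≤ i, a j = 0 := by
  induction i with
  | zero =>
    intro j hj
    obtain rfl : j = 0 := by omega
    simpa [langPoly] using h
  | succ i ih =>
    have ha : a (i + 1) = 0 := by
      have h1 : (X ^ p) ^ p ∣ langPoly p a i ^ p := pow_dvd_pow_of_dvd (X_pow_dvd_langPoly hp a i) p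
      rw [← pow_mul, X_pow_dvd_iff] at h1
      have h2 := h1 p (by nlinarith [hp.two_le])
      have h3 := congrArg (fun q => q.coeff p) h
      simpa [langPoly, h2] using h3
    have hi : langPoly p a i = 0 := by
      simpa [langPoly, ha, hp.ne_zero] using h
    intro j hj
    rcases Nat.lt_or_ge j (i + 1) with hlt | hge
    · exact ih hi j (by omega)
    · rwa [show j = i + 1 by omega]

open Polynomial in
theorem exists_ne_zero_eval_langPoly {k : Type*} [Field k] [IsAlgClosed k] {p : ℕ} (hp : p.Prime)
    (a : ℕ → k) (m : ℕ) (ha : ∃ j ≤ m, a j ≠ 0) :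
    ∃ y : k, y ≠ 0 ∧ (langPoly p a m).eval y = y := by
  have hne : langPoly p a m ≠ 0 := fun h => by
    obtain ⟨j, hj, hj'⟩ := ha
    exact hj' (eq_zero_of_langPoly_eq_zero hp a m h j hj)
  obtain ⟨R, hR⟩ : X ^ 2 ∣ langPoly p a m :=
    (pow_dvd_pow X hp.two_le).trans (X_pow_dvd_langPoly hp a m)
  have hR0 : R ≠ 0 := by
    rintro rfl
    exact hne (by simpa using hR)
  have hdeg : (R * X - 1).degree ≠ 0 := by
    have hpos : 0 < (R * X).degree := by
      rw [degree_mul_X, degree_eq_natDegree hR0]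
      exact_mod_cast R.natDegree.succ_pos
    rw [← C_1, degree_sub_C hpos]
    exact hpos.ne'
  obtain ⟨y, hy⟩ := IsAlgClosed.exists_root _ hdeg
  have hy' : R.eval y * y = 1 := by simpa [IsRoot, sub_eq_zero] using hy
  refine ⟨y, ?_, ?_⟩
  · rintro rfl
    simp at hy'
  · rw [hR]
    simp only [eval_mul, eval_pow, eval_X]
    linear_combination y * hy'

theorem exists_linearIndependent_iterate {k V : Type*} [Field k] [AddCommGroup V] [Module k V]
    [FiniteDimensional k V] (f : V → V) {v : V} (hv : v ≠ 0) :
    ∃ (m : ℕ) (a : ℕ → k), LinearIndependent k (fun i : Fin (m + 1) => f^[i] v) ∧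
      f^[m + 1] v = ∑ i ∈ Finset.range (m + 1), a i • f^[i] v := by
  classical
  have hex : ∃ n : ℕ, ¬ LinearIndependent k (fun i : Fin n => f^[i] v) :=
    ⟨Module.finrank k V + 1, fun h => by simpa using h.fintype_card_le_finrank⟩
  obtain ⟨m, hm⟩ : ∃ m, Nat.find hex = m + 2 := by
    have h0 : Nat.find hex ≠ 0 := fun h => by
      have := Nat.find_spec hex
      rw [h] at this
      exact this linearIndependent_empty_type
    have h1 : Nat.find hex ≠ 1 := fun h => by
      have := Nat.find_spec hex
      rw [h] at this
      exact this (.of_subsingleton 0 (by simpa using hv))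
    exact ⟨Nat.find hex - 2, by omega⟩
  have hind : LinearIndependent k (fun i : Fin (m + 1) => f^[i] v) :=
    not_not.1 (Nat.find_min hex (by omega : m + 1 < Nat.find hex))
  have hdep := Nat.find_spec hex
  rw [hm, linearIndependent_finSucc'] at hdep
  have hmem : f^[m + 1] v ∈ Submodule.span k (Set.range fun i : Fin (m + 1) => f^[i] v) := by
    by_contra hcon
    exact hdep ⟨hind, hcon⟩
  obtain ⟨c, hc⟩ := (Submodule.mem_span_range_iff_exists_fun k).1 hmem
  refine ⟨m, fun i => if h : i < m + 1 then c ⟨i, h⟩ else 0, hind, ?_⟩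
  rw [← hc, Finset.sum_range]
  exact Finset.sum_congr rfl fun i _ => by simp only [i.2, dif_pos, Fin.eta]

/-- An injective Frobenius-semilinear endomorphism of a nonzero finite-dimensional space over an
algebraically closed field has a nonzero fixed vector. -/
theorem exists_ne_zero_fixed_of_frobenius_semilinear {p : ℕ} [Fact p.Prime] {k V : Type*} [Field k]
    [IsAlgClosed k] [CharP k p] [AddCommGroup V] [Module k V] [FiniteDimensional k V] [Nontrivial V]
    (f : V →ₛₗ[frobenius k p] V) (hf : Function.Injective f) : ∃ w : V, w ≠ 0 ∧ f w = w := by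
  have hp : p.Prime := Fact.out
  obtain ⟨v, hv⟩ := exists_ne (0 : V)
  obtain ⟨m, a, hind, hrel⟩ := exists_linearIndependent_iterate (k := k) f hv
  have ha : ∃ j ≤ m, a j ≠ 0 := by
    by_contra! h
    rw [Finset.sum_eq_zero fun i hi => by
      rw [h i (by simpa [Nat.lt_succ_iff] using hi), zero_smul]] at hrel
    exact hv (hf.iterate (m + 1) (hrel.trans (iterate_map_zero f _).symm))
  obtain ⟨y, hy0, hy⟩ := exists_ne_zero_eval_langPoly hp a m ha
  set x : ℕ → k := fun i => (langPoly p a i).eval y with hx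
  have hx0 : x 0 = y ^ p * a 0 := by
    simp only [hx, langPoly, Polynomial.eval_mul, Polynomial.eval_pow,
      Polynomial.eval_C, Polynomial.eval_X]
    ring
  have hxs (i : ℕ) : x (i + 1) = x i ^ p + y ^ p * a (i + 1) := by
    simp only [hx, langPoly, Polynomial.eval_add, Polynomial.eval_mul, Polynomial.eval_pow,
      Polynomial.eval_C, Polynomial.eval_X]
    ring
  have hxm : x m = y := hy
  refine ⟨∑ i ∈ Finset.range (m + 1), x i • f^[i] v, fun h => ?_, ?_⟩
  · rw [Finset.sum_range] at h
    have := Fintype.linearIndependent_iff.1 hind (fun i => x i) h (Fin.last m)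
    exact hy0 (hxm.symm.trans this)
  · simp only [map_sum, LinearMap.map_smulₛₗ, frobenius_def, ← Function.iterate_succ_apply']
    rw [Finset.sum_range_succ, hxm, hrel, Finset.smul_sum, Finset.sum_range_succ' _ m,
      Finset.sum_range_succ' (fun i => x i • f^[i] v), ← add_assoc, ← Finset.sum_add_distrib, hx0]
    simp only [hxs, add_smul, mul_smul]

theorem exists_pow_sub_self_eq {k : Type*} [Field k] [IsAlgClosed k] {p : ℕ} (hp : 1 < p) (c : k) :
    ∃ d : k, d ^ p - d = c := by
  open Polynomial in
  have hdeg : (X ^ p - X - C c : k[X]).degree ≠ 0 := by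
    have h1 : (X ^ p - X : k[X]).degree = p := by
      rw [degree_sub_eq_left_of_degree_lt] <;> simp [hp]
    rw [degree_sub_C (by rw [h1]; exact_mod_cast (by omega : 0 < p)), h1]
    exact_mod_cast (by omega : p ≠ 0)
  obtain ⟨d, hd⟩ := IsAlgClosed.exists_root _ hdeg
  exact ⟨d, by simpa [Polynomial.IsRoot, sub_eq_zero] using hd⟩

theorem span_fixed_eq_top_of_frobenius_semilinear {p : ℕ} [Fact p.Prime] {k V : Type*} [Field k]
    [IsAlgClosed k] [CharP k p] [AddCommGroup V] [Module k V] [FiniteDimensional k V]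
    (f : V →ₛₗ[frobenius k p] V) (hf : Function.Injective f) :
    Submodule.span k {v : V | f v = v} = ⊤ := by
  have hp : p.Prime := Fact.out
  set W := Submodule.span k {v : V | f v = v} with hW
  have hWf : W ≤ W.comap f := Submodule.span_le.2 fun v hv => by
    have hv' : f v = v := hv
    change f v ∈ W
    rw [hv']
    exact Submodule.subset_span hv
  have hinv (x : V) (hx : f x ∈ W) : x ∈ W := by
    obtain ⟨n, c, g, hc⟩ := Submodule.mem_span_set'.1 hx
    choose d hd using fun i => IsAlgClosed.exists_pow_nat_eq (c i) hp.pos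
    have : f (∑ i, d i • (g i : V)) = f x := by
      rw [← hc]
      simp only [map_sum, LinearMap.map_smulₛₗ, frobenius_def, hd]
      exact Finset.sum_congr rfl fun i _ => by rw [(g i).2]
    rw [← hf this]
    exact Submodule.sum_mem _ fun i _ => W.smul_mem _ (Submodule.subset_span (g i).2)
  have hsolve (w : V) (hw : w ∈ W) : ∃ u ∈ W, f u - u = w := by
    obtain ⟨n, c, g, hc⟩ := Submodule.mem_span_set'.1 hw
    choose d hd using fun i => exists_pow_sub_self_eq hp.one_lt (c i)
    refine ⟨∑ i, d i • (g i : V),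
      Submodule.sum_mem _ fun i _ => W.smul_mem _ (Submodule.subset_span (g i).2), ?_⟩
    rw [← hc]
    simp only [map_sum, LinearMap.map_smulₛₗ, frobenius_def, ← Finset.sum_sub_distrib]
    exact Finset.sum_congr rfl fun i _ => by rw [(g i).2, ← sub_smul, hd]
  by_contra hne
  have : Nontrivial (V ⧸ W) := Submodule.Quotient.nontrivial_iff.2 hne
  have hinj : Function.Injective (W.mapQ W f hWf) := by
    rw [injective_iff_map_eq_zero]
    intro q
    obtain ⟨x, rfl⟩ := W.mkQ_surjective q
    intro hq
    exact (Submodule.Quotient.mk_eq_zero W).2 (hinv x ((Submodule.Quotient.mk_eq_zero W).1 hq))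
  obtain ⟨q, hq0, hq⟩ := exists_ne_zero_fixed_of_frobenius_semilinear _ hinj
  obtain ⟨x, rfl⟩ := W.mkQ_surjective q
  obtain ⟨u, huW, hu⟩ := hsolve (f x - x) ((Submodule.Quotient.eq W).1 hq)
  have hfix : x - u ∈ W := Submodule.subset_span (by
    change f (x - u) = x - u
    rw [map_sub, eq_add_of_sub_eq hu]
    abel)
  exact hq0 ((Submodule.Quotient.mk_eq_zero W).2 (by simpa using W.add_mem hfix huW))

theorem card_pow_eq_self {p : ℕ} [Fact p.Prime] {k : Type*} [Field k] [CharP k p] :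
    Nat.card {c : k // c ^ p = c} = p := by
  exact (Nat.card_congr (Equiv.subtypeEquivRight fun _ =>
    (Subfield.mem_bot_iff_pow_eq_self k p).symm)).trans (Subfield.card_bot k p)

/-- Coordinates of fixed vectors with respect to a basis of fixed vectors. -/
noncomputable def fixedEquivOfBasis {p : ℕ} [Fact p.Prime] {k V ι : Type*} [Field k] [CharP k p]
    [AddCommGroup V] [Module k V] [Fintype ι] (f : V →ₛₗ[frobenius k p] V)
    (b : Module.Basis ι k V) (hb : ∀ i, f (b i) = b i) :
    {v : V // f v = v} ≃ (ι → {c : k // c ^ p = c}) :=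
  (b.equivFun.toEquiv.subtypeEquiv (q := fun c => ∀ i, c i ^ p = c i) fun v => by
    have hv : f v = ∑ i, (b.equivFun v i) ^ p • b i := by
      conv_lhs => rw [← b.sum_equivFun v]
      simp only [map_sum, LinearMap.map_smulₛₗ, frobenius_def, hb]
    rw [← b.equivFun.injective.eq_iff, hv, ← b.equivFun_symm_apply,
      LinearEquiv.apply_symm_apply, funext_iff]
    rfl).trans (Equiv.subtypePiEquivPi (p := fun _ c => c ^ p = c))

/-- Lang-type theorem: for a bijective Frobenius-semilinear
endomorphism `f` of a finite-dimensional vector space `V` over an algebraically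
closed field `k` of characteristic `p`, the fixed-point set is an `𝔽_p`-subspace
(equivalently, since `V` has exponent `p`, an additive subgroup), its `k`-span is
all of `V`, and it is finite of cardinality `p ^ dim_k V`. -/
theorem stratified_stmt3 (p : ℕ) (hp : p.Prime) (k : Type*) [Field k]
    [IsAlgClosed k] (hchar : CharP k p)
    (V : Type*) [AddCommGroup V] [Module k V] [FiniteDimensional k V]
    (f : V → V) (hadd : ∀ v w : V, f (v + w) = f v + f w)
    (hsmul : ∀ (a : k) (v : V), f (a • v) = a ^ p • f v)
    (hbij : Function.Bijective f) :
    (∃ S : AddSubgroup V, (S : Set V) = {v : V | f v = v}) ∧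
    Submodule.span k {v : V | f v = v} = ⊤ ∧
    {v : V | f v = v}.Finite ∧
    Nat.card {v : V // f v = v} = p ^ Module.finrank k V := by
  have : Fact p.Prime := ⟨hp⟩
  let F : V →ₛₗ[frobenius k p] V :=
    { toFun := f, map_add' := hadd, map_smul' := hsmul }
  have hspan : Submodule.span k {v : V | f v = v} = ⊤ :=
    span_fixed_eq_top_of_frobenius_semilinear F hbij.injective
  let b := Module.Basis.ofSpan hspan.ge
  have hb (i) : F (b i) = b i := Module.Basis.ofSpan_subset hspan.ge ⟨i, rfl⟩
  have := Module.Finite.finite_basis b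
  have := Fintype.ofFinite ((linearIndepOn_empty k id).extend
    (Set.empty_subset {v : V | f v = v}))
  have hcard : Nat.card {v : V // f v = v} = p ^ Module.finrank k V := by
    refine (Nat.card_congr (fixedEquivOfBasis F b hb)).trans ?_
    rw [Nat.card_fun, card_pow_eq_self, Module.finrank_eq_nat_card_basis b]
  refine ⟨⟨F.toAddMonoidHom.eqLocus (AddMonoidHom.id V), rfl⟩, hspan, ?_, hcard⟩
  exact Set.finite_coe_iff.1 (Nat.finite_of_card_ne_zero
    (hcard.trans_ne (pow_ne_zero _ hp.ne_zero)))
end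

section
/- Let p be a prime, k an algebraically closed field of characteristic p, V a finite-dimensional k-vector space, and f : V → V a Frobenius-semilinear endomorphism. If the only vector v ∈ V with f(v) = v is v = 0, then f is nilpotent: there exists a natural number N such that f^[N](v) = 0 for all v ∈ V. -/
open Polynomial in
/-- Iterating `y ↦ y ^ p + a i * t ^ p` from `a 0 * t ^ p`, the `n`-th value can be made equal to
the nonzero parameter `t`. -/
theorem exists_ne_zero_frobenius_recursion {k : Type*} [Field k] [IsAlgClosed k] {p : ℕ}
    (hp : 1 < p) (a : ℕ → k) (ha : a 0 ≠ 0) (n : ℕ) :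
    ∃ (t : k) (y : ℕ → k), t ≠ 0 ∧ y 0 = a 0 * t ^ p ∧
      (∀ i, y (i + 1) = y i ^ p + a (i + 1) * t ^ p) ∧ y n = t := by
  let y : k → ℕ → k := fun t i ↦ Nat.rec (a 0 * t ^ p) (fun j z ↦ z ^ p + a (j + 1) * t ^ p) i
  have hpow : ∀ t : k, t ^ p = t * t ^ (p - 1) := fun t ↦ by
    rw [← pow_succ', Nat.sub_add_cancel hp.le]
  have key : ∀ i, ∃ R : k[X], 0 < R.natDegree ∧ R.eval 0 = 0 ∧ ∀ t, y t i = t * R.eval t := by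
    intro i
    induction i with
    | zero =>
      refine ⟨C (a 0) * X ^ (p - 1), ?_, ?_, fun t ↦ ?_⟩
      · rw [natDegree_C_mul_X_pow _ _ ha]; omega
      · simp [show p - 1 ≠ 0 by omega]
      · change a 0 * t ^ p = _
        rw [hpow]
        simp only [eval_mul, eval_C, eval_pow, eval_X]
        ring
    | succ i ih =>
      obtain ⟨R, hR, -, hy⟩ := ih
      have hd : 0 < (R ^ p + C (a (i + 1))).natDegree := by
        rw [natDegree_add_C, natDegree_pow]
        positivity
      refine ⟨X ^ (p - 1) * (R ^ p + C (a (i + 1))), ?_, ?_, fun t ↦ ?_⟩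
      · rw [natDegree_mul (by simp) (ne_zero_of_natDegree_gt hd)]
        omega
      · simp [show p - 1 ≠ 0 by omega]
      · change y t i ^ p + a (i + 1) * t ^ p = _
        rw [hy, mul_pow, hpow]
        simp only [eval_mul, eval_C, eval_pow, eval_X, eval_add]
        ring
  obtain ⟨R, hR, hR0, hy⟩ := key n
  obtain ⟨t, ht⟩ := IsAlgClosed.exists_root (R - C 1) (by
    refine ne_of_gt (natDegree_pos_iff_degree_pos.mp ?_)
    rwa [natDegree_sub_C])
  have ht1 : R.eval t = 1 := by simpa [sub_eq_zero] using ht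
  refine ⟨t, y t, ?_, rfl, fun i ↦ rfl, by rw [hy, ht1, mul_one]⟩
  rintro rfl
  exact zero_ne_one (hR0.symm.trans ht1)

/-- In a Noetherian module some term of a sequence is a combination of the previous ones. -/
theorem exists_eq_sum_range_smul {R M : Type*} [Ring R] [AddCommGroup M] [Module R M]
    [IsNoetherian R M] (v : ℕ → M) :
    ∃ (n : ℕ) (a : ℕ → R), v n = ∑ i ∈ Finset.range n, a i • v i := by
  let S : ℕ →o Submodule R M :=
    ⟨fun n ↦ Submodule.span R (v '' (Finset.range n : Set ℕ)), fun m n h ↦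
      Submodule.span_mono (Set.image_mono (by simpa using h))⟩
  obtain ⟨n, hn⟩ := monotone_stabilizes_iff_noetherian.mpr ‹_› S
  have hmem : v n ∈ S n := by
    rw [hn (n + 1) n.le_succ]
    exact Submodule.subset_span ⟨n, by simp, rfl⟩
  obtain ⟨a, ha⟩ := (Submodule.mem_span_image_finset_iff_exists_fun' R).mp hmem
  exact ⟨n, a, ha.symm⟩

/-- A Frobenius-semilinear endomorphism with a non-nilpotent vector has a nonzero fixed vector. -/
theorem exists_ne_zero_fixed_of_iterate_ne_zero {k V : Type*} [Field k] [IsAlgClosed k]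
    [AddCommGroup V] [Module k V] [FiniteDimensional k V] {p : ℕ} (hp : 1 < p) (f : V →+ V)
    (hsmul : ∀ (a : k) (v : V), f (a • v) = a ^ p • f v) (v : V) (hv : ∀ m, f^[m] v ≠ 0) :
    ∃ u, u ≠ 0 ∧ f u = u := by
  classical
  have hex : ∃ n, ∃ w : V, (∀ m, f^[m] w ≠ 0) ∧
      ∃ a : ℕ → k, f^[n] w = ∑ i ∈ Finset.range n, a i • f^[i] w := by
    obtain ⟨n, a, h⟩ := exists_eq_sum_range_smul (R := k) fun i ↦ f^[i] v
    exact ⟨n, v, hv, a, h⟩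
  obtain ⟨w, hw, a, ha⟩ := Nat.find_spec hex
  have hmin := fun m ↦ Nat.find_min hex (m := m)
  generalize Nat.find hex = N at ha hmin
  obtain _ | n := N
  · exact absurd (by simpa using ha) (hw 0)
  have ha0 : a 0 ≠ 0 := by
    intro h0
    refine hmin n n.lt_succ_self ⟨f w, fun m ↦ hw (m + 1), fun i ↦ a (i + 1), ?_⟩
    rw [Finset.sum_range_succ', h0, zero_smul, add_zero] at ha
    exact ha
  obtain ⟨t, y, ht, hy0, hy, hyn⟩ := exists_ne_zero_frobenius_recursion hp a ha0 n
  refine ⟨∑ i ∈ Finset.range (n + 1), y i • f^[i] w, fun hu ↦ ?_, ?_⟩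
  · refine hmin n n.lt_succ_self ⟨w, hw, fun i ↦ -(t⁻¹ * y i), ?_⟩
    rw [Finset.sum_range_succ, hyn, add_comm, add_eq_zero_iff_eq_neg] at hu
    simp only [neg_smul, mul_smul, Finset.sum_neg_distrib, ← Finset.smul_sum]
    rw [← smul_neg, ← hu, inv_smul_smul₀ ht]
  · have hf : f (∑ i ∈ Finset.range (n + 1), y i • f^[i] w) =
        ∑ i ∈ Finset.range (n + 1), y i ^ p • f^[i + 1] w := by
      simp only [map_sum, hsmul, Function.iterate_succ_apply']
    rw [hf, Finset.sum_range_succ, hyn, ha, Finset.sum_range_succ', Finset.sum_range_succ',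
      smul_add, Finset.smul_sum, ← add_assoc, ← Finset.sum_add_distrib, hy0]
    simp only [hy, add_smul, smul_smul, mul_comm (t ^ p)]

/-- A Frobenius-semilinear endomorphism of a finite-dimensional
vector space over an algebraically closed field of characteristic `p` with no
nonzero fixed vector is nilpotent. -/
theorem stratified_stmt4 (p : ℕ) (hp : p.Prime) (k : Type*) [Field k]
    [IsAlgClosed k] (hchar : CharP k p)
    (V : Type*) [AddCommGroup V] [Module k V] [FiniteDimensional k V]
    (f : V → V) (hadd : ∀ v w : V, f (v + w) = f v + f w)
    (hsmul : ∀ (a : k) (v : V), f (a • v) = a ^ p • f v)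
    (hfix : ∀ v : V, f v = v → v = 0) :
    ∃ N : ℕ, ∀ v : V, f^[N] v = 0 := by
  let g : V →+ V := AddMonoidHom.mk' f hadd
  have hnil : ∀ v, ∃ m, f^[m] v = 0 := by
    by_contra! ⟨v, hv⟩
    obtain ⟨u, hu, hfu⟩ := exists_ne_zero_fixed_of_iterate_ne_zero hp.one_lt g hsmul v hv
    exact hu (hfix u hfu)
  choose m hm using hnil
  let b := Module.finBasis k V
  have hzero : ∀ n, f^[n] 0 = 0 := Function.iterate_fixed (map_zero g)
  have hsmul_iter : ∀ n (a : k) (v : V), f^[n] (a • v) = a ^ p ^ n • f^[n] v := by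
    intro n a v
    induction n with
    | zero => simp
    | succ n ih => simp only [Function.iterate_succ_apply', ih, hsmul, ← pow_mul, ← pow_succ]
  let N := Finset.univ.sup fun i ↦ m (b i)
  have hb : ∀ i, f^[N] (b i) = 0 := fun i ↦ by
    have hi : m (b i) ≤ N := Finset.le_sup (f := fun i ↦ m (b i)) (Finset.mem_univ i)
    rw [← Nat.sub_add_cancel hi, Function.iterate_add_apply, hm, hzero]
  refine ⟨N, fun v ↦ ?_⟩
  have hsum : f^[N] (∑ i, b.repr v i • b i) = ∑ i, f^[N] (b.repr v i • b i) :=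
    map_sum (AddMonoidHom.mk' f^[N] fun x y ↦ iterate_map_add g N x y) _ _
  rw [← b.sum_repr v, hsum]
  exact Finset.sum_eq_zero fun i _ ↦ by rw [hsmul_iter, hb, smul_zero]
end

section
/- Let p be a prime, k an algebraically closed field of characteristic p, V a finite-dimensional k-vector space, and f : V → V a Frobenius-semilinear endomorphism such that the only vector v ∈ V with f(v) = v is v = 0. Then every sequence v : ℕ → V satisfying f(v_{n+1}) = v_n for all n ∈ ℕ is identically zero, i.e. v_n = 0 for all n. -/
open Polynomial in
/-- The coefficients, as polynomials in the last one, of a fixed vector of a Frobenius-semilinear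
map on a cyclic space whose top iterate is the combination of the lower ones given by `a`. -/
noncomputable def fixedVectorPoly {k : Type*} [Field k] (p : ℕ) (a : ℕ → k) : ℕ → k[X]
  | 0 => C (a 0) * X ^ p
  | i + 1 => fixedVectorPoly p a i ^ p + C (a (i + 1)) * X ^ p

open Polynomial in
theorem X_pow_dvd_fixedVectorPoly {k : Type*} [Field k] {p : ℕ} (hp : p ≠ 0) (a : ℕ → k) (i : ℕ) :
    (X : k[X]) ^ p ∣ fixedVectorPoly p a i := by
  induction i with
  | zero => exact dvd_mul_left _ _
  | succ i ih => exact dvd_add (dvd_pow ih hp) (dvd_mul_left _ _)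

open Polynomial in
theorem coeff_eq_zero_of_fixedVectorPoly_eq_zero {k : Type*} [Field k] {p : ℕ} (hp : 1 < p)
    (a : ℕ → k) (i : ℕ) (h : fixedVectorPoly p a i = 0) : ∀ j ≤ i, a j = 0 := by
  induction i with
  | zero =>
    intro j hj
    obtain rfl : j = 0 := by omega
    simpa [fixedVectorPoly] using h
  | succ i ih =>
    rw [fixedVectorPoly] at h
    have hlt : p < p * p := by nlinarith
    have hdvd : (X : k[X]) ^ (p * p) ∣ fixedVectorPoly p a i ^ p := by
      rw [pow_mul]
      exact pow_dvd_pow_of_dvd (X_pow_dvd_fixedVectorPoly (by omega) a i) p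
    have ha : a (i + 1) = 0 := by
      have hc := congrArg (fun q : k[X] => q.coeff p) h
      simpa [X_pow_dvd_iff.mp hdvd p hlt] using hc
    have hi : fixedVectorPoly p a i = 0 := by
      rw [ha, C_0, zero_mul, add_zero] at h
      exact (pow_eq_zero_iff (by omega : p ≠ 0)).mp h
    intro j hj
    rcases Nat.lt_or_ge i j with hij | hij
    · obtain rfl : j = i + 1 := by omega
      exact ha
    · exact ih hi j hij

open Polynomial in
theorem exists_ne_zero_eval_eq_self {k : Type*} [Field k] [IsAlgClosed k] {q : k[X]}
    (hq : q ≠ 0) (hdvd : X ^ 2 ∣ q) : ∃ t : k, t ≠ 0 ∧ q.eval t = t := by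
  obtain ⟨r, rfl⟩ := hdvd
  have hr : r ≠ 0 := right_ne_zero_of_mul hq
  have hdeg : (X * r - C 1).degree ≠ 0 := by
    have hpos : 0 < (X * r).natDegree := by
      rw [natDegree_X_mul hr]
      omega
    rw [degree_sub_C (natDegree_pos_iff_degree_pos.mp hpos)]
    exact (natDegree_pos_iff_degree_pos.mp hpos).ne'
  obtain ⟨t, ht⟩ := IsAlgClosed.exists_root _ hdeg
  have ht' : t * r.eval t = 1 := by
    simpa [sub_eq_zero] using ht
  refine ⟨t, left_ne_zero_of_mul_eq_one ht', ?_⟩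
  rw [eval_mul, eval_pow, eval_X, pow_two, mul_assoc, ht', mul_one]

open Finset in
theorem exists_iterate_eq_sum {k V : Type*} [Field k] [AddCommGroup V] [Module k V]
    [FiniteDimensional k V] (f : V → V) (w : V) :
    ∃ (m : ℕ) (a : ℕ → k), f^[m] w = ∑ i ∈ range m, a i • f^[i] w := by
  let S : ℕ →o Submodule k V :=
    ⟨fun n => Submodule.span k ((fun i => f^[i] w) '' (range n : Set ℕ)), fun m n hmn =>
      Submodule.span_mono (Set.image_mono (by simpa using hmn))⟩
  obtain ⟨n, hn⟩ := monotone_stabilizes_iff_noetherian.mpr (inferInstance : IsNoetherian k V) S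
  have hmem : f^[n] w ∈ S n := by
    rw [hn (n + 1) (Nat.le_succ n)]
    exact Submodule.subset_span ⟨n, by simp, rfl⟩
  obtain ⟨a, ha⟩ := Submodule.mem_span_image_finset_iff_exists_fun' k |>.mp hmem
  exact ⟨n, a, ha.symm⟩

open Finset in
/-- A Frobenius-semilinear endomorphism without nonzero fixed vectors is locally nilpotent. -/
theorem exists_iterate_eq_zero_of_fixed_eq_zero {k V : Type*} [Field k] [IsAlgClosed k]
    [AddCommGroup V] [Module k V] [FiniteDimensional k V] {p : ℕ} (hp : 1 < p) (f : V →+ V)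
    (hsmul : ∀ (a : k) (v : V), f (a • v) = a ^ p • f v)
    (hfix : ∀ v : V, f v = v → v = 0) (w : V) : ∃ m : ℕ, f^[m] w = 0 := by
  classical
  have hex := exists_iterate_eq_sum (k := k) f w
  obtain ⟨a, ha⟩ := Nat.find_spec hex
  have hmin := fun m (hm : m < Nat.find hex) => Nat.find_min hex hm
  refine ⟨Nat.find hex, ?_⟩
  generalize Nat.find hex = n at ha hmin
  rcases n with _ | n
  · simpa using ha
  by_cases hG : fixedVectorPoly p a n = 0
  · rw [ha]
    refine sum_eq_zero fun i hi => ?_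
    rw [coeff_eq_zero_of_fixedVectorPoly_eq_zero hp a n hG i
      (Nat.lt_succ_iff.mp (mem_range.mp hi)), zero_smul]
  obtain ⟨t, ht0, ht⟩ := exists_ne_zero_eval_eq_self hG
    ((pow_dvd_pow _ hp).trans (X_pow_dvd_fixedVectorPoly (by omega) a n))
  set g : ℕ → k := fun i => (fixedVectorPoly p a i).eval t with hg
  have hg0 : g 0 = a 0 * t ^ p := by simp [hg, fixedVectorPoly]
  have hgs (i : ℕ) : g (i + 1) = g i ^ p + a (i + 1) * t ^ p := by
    simp [hg, fixedVectorPoly]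
  have hx : ∑ i ∈ range (n + 1), g i • f^[i] w = 0 := by
    apply hfix
    have hf : f (∑ i ∈ range (n + 1), g i • f^[i] w) =
        ∑ i ∈ range n, g i ^ p • f^[i + 1] w + t ^ p • f^[n + 1] w := by
      rw [map_sum, sum_range_succ]
      simp only [hsmul, ← Function.iterate_succ_apply' f]
      rw [show g n = t from ht]
    rw [hf, ha, smul_sum, sum_range_succ' (fun i => t ^ p • a i • f^[i] w),
      sum_range_succ' (fun i => g i • f^[i] w), ← add_assoc, ← sum_add_distrib, hg0, mul_comm (a 0), mul_smul]
    congr 1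
    refine sum_congr rfl fun i _ => ?_
    rw [hgs, add_smul, mul_comm (a (i + 1)), mul_smul]
  refine absurd ⟨fun i => -(t⁻¹ * g i), ?_⟩ (hmin n (Nat.lt_succ_self n))
  rw [sum_range_succ, show g n = t from ht, add_comm, add_eq_zero_iff_eq_neg] at hx
  rw [← inv_smul_smul₀ ht0 (f^[n] w), hx, smul_neg, smul_sum, ← sum_neg_distrib]
  exact sum_congr rfl fun i _ => by rw [neg_smul, mul_smul]

/-- A locally nilpotent Frobenius-semilinear endomorphism of a finite-dimensional space is
nilpotent. -/
theorem exists_forall_iterate_eq_zero {k V : Type*} [Field k]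
    [AddCommGroup V] [Module k V] [FiniteDimensional k V] {p : ℕ} (f : V →+ V)
    (hsmul : ∀ (a : k) (v : V), f (a • v) = a ^ p • f v)
    (h : ∀ w : V, ∃ m : ℕ, f^[m] w = 0) : ∃ N : ℕ, ∀ w : V, f^[N] w = 0 := by
  have hiter (n : ℕ) (a : k) (v : V) (hv : f^[n] v = 0) : f^[n] (a • v) = 0 := by
    induction n generalizing a v with
    | zero => simp_all
    | succ n ih =>
      rw [Function.iterate_succ_apply, hsmul]
      exact ih _ _ hv
  let K : ℕ →o Submodule k V :=
    { toFun := fun n =>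
        { carrier := {v | f^[n] v = 0}
          add_mem' := fun {x y} hx hy => by
            simp only [Set.mem_ofPred_eq] at hx hy ⊢
            rw [iterate_map_add, hx, hy, add_zero]
          zero_mem' := iterate_map_zero f n
          smul_mem' := fun a v hv => hiter n a v hv }
      monotone' := fun m n hmn v hv => by
        change f^[n] v = 0
        rw [← Nat.sub_add_cancel hmn, Function.iterate_add_apply, show f^[m] v = 0 from hv]
        exact iterate_map_zero f _ }
  obtain ⟨N, hN⟩ := monotone_stabilizes_iff_noetherian.mpr (inferInstance : IsNoetherian k V) K
  refine ⟨N, fun w => ?_⟩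
  obtain ⟨m, hm⟩ := h w
  have hw : w ∈ K (max N m) := K.monotone (le_max_right N m) hm
  rwa [← hN _ (le_max_left N m)] at hw

/-- If a Frobenius-semilinear endomorphism `f` of a finite-dimensional
vector space over an algebraically closed field of characteristic `p` has no nonzero
fixed vector, then any sequence `(v_n)` with `f (v_{n+1}) = v_n` is identically `0`
(vanishing of the inverse limit of the system `(V, f)`). -/
theorem stratified_stmt5 (p : ℕ) (hp : p.Prime) (k : Type*) [Field k]
    [IsAlgClosed k] (hchar : CharP k p)
    (V : Type*) [AddCommGroup V] [Module k V] [FiniteDimensional k V]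
    (f : V → V) (hadd : ∀ v w : V, f (v + w) = f v + f w)
    (hsmul : ∀ (a : k) (v : V), f (a • v) = a ^ p • f v)
    (hfix : ∀ v : V, f v = v → v = 0)
    (v : ℕ → V) (hv : ∀ n : ℕ, f (v (n + 1)) = v n) :
    ∀ n : ℕ, v n = 0 := by
  let F : V →+ V := AddMonoidHom.mk' f hadd
  obtain ⟨N, hN⟩ := exists_forall_iterate_eq_zero F hsmul
    (exists_iterate_eq_zero_of_fixed_eq_zero hp.one_lt F hsmul hfix)
  have hshift (m n : ℕ) : f^[m] (v (n + m)) = v n := by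
    induction m with
    | zero => rfl
    | succ m ih => rw [Function.iterate_succ_apply, ← add_assoc, hv, ih]
  intro n
  rw [← hshift N n]
  exact hN _
end

section
/- Let X be a topological space with only finitely many irreducible components, let U ⊆ X be a dense open subset, and let f : U → X be a continuous map whose image f(U) is dense in X. Then there exists a bijection σ from the (finite) set of irreducible components of X to itself such that for every irreducible component C of X, the closure of f(U ∩ C) equals σ(C). In particular, some positive power of σ is the identity permutation. -/
/-- A dense set meets every irreducible component, if these are finite in number. -/
theorem Dense.inter_nonempty_of_mem_irreducibleComponents {X : Type*} [TopologicalSpace X]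
    (hfin : (irreducibleComponents X).Finite) {U : Set X} (hU : Dense U) {C : Set X}
    (hC : C ∈ irreducibleComponents X) : (U ∩ C).Nonempty := by
  have hcl := closure_sUnion_irreducibleComponents_sdiff_singleton hfin C hC
  have hopen : IsOpen (⋃₀ (irreducibleComponents X \ {C}))ᶜ := by
    rw [isOpen_compl_iff, Set.sUnion_eq_biUnion]
    exact hfin.sdiff.isClosed_biUnion fun W hW ↦ isClosed_of_mem_irreducibleComponents W hW.1
  have hne : (⋃₀ (irreducibleComponents X \ {C}))ᶜ.Nonempty := by
    rw [← closure_nonempty_iff, hcl]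
    exact hC.1.nonempty
  obtain ⟨x, hxV, hxU⟩ := hU.inter_open_nonempty _ hopen hne
  exact ⟨x, hxU, hcl ▸ subset_closure hxV⟩

/-- A continuous map sends the trace of an irreducible set on an open set to an irreducible set. -/
theorem IsIrreducible.image_preimage_val {X Y : Type*} [TopologicalSpace X] [TopologicalSpace Y]
    {U C : Set X} (hC : IsIrreducible C) (hU : IsOpen U) (hne : (U ∩ C).Nonempty) {f : U → Y}
    (hf : Continuous f) : IsIrreducible (f '' {x : U | (x : X) ∈ C}) := by
  obtain ⟨x, hxU, hxC⟩ := hne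
  have hpre : IsIrreducible {x : U | (x : X) ∈ C} :=
    ⟨⟨⟨x, hxU⟩, hxC⟩, hC.isPreirreducible.preimage hU.isOpenEmbedding_subtypeVal⟩
  exact hpre.image f hf.continuousOn

/-- If finitely many irreducible sets have dense union, each irreducible component is the closure
of one of them. -/
theorem exists_closure_eq_of_mem_irreducibleComponents {X ι : Type*} [TopologicalSpace X]
    [Finite ι] {s : ι → Set X} (hs : ∀ i, IsIrreducible (s i)) (hdense : Dense (⋃ i, s i))
    {Z : Set X} (hZ : Z ∈ irreducibleComponents X) : ∃ i, closure (s i) = Z := by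
  have hcover : Z ⊆ ⋃₀ Set.range fun i ↦ closure (s i) := by
    rw [Set.sUnion_range, ← closure_iUnion_of_finite, hdense.closure_eq]
    exact Set.subset_univ Z
  obtain ⟨_, hmem, hsub⟩ := isIrreducible_iff_sUnion_isClosed.mp hZ.1
    (Set.finite_range fun i ↦ closure (s i)).toFinset
    (by simp) (by simpa using hcover)
  obtain ⟨i, rfl⟩ := (Set.Finite.mem_toFinset _).mp hmem
  exact ⟨i, (hZ.2 (hs i).closure hsub).antisymm hsub⟩

/-- A continuous map with dense image, defined on a dense open subset
of a topological space with finitely many irreducible components, permutes the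
irreducible components: there is a permutation `σ` of the set of irreducible
components such that the closure of the image of (the trace on the domain of) each
component `C` is `σ C`; and some positive power of `σ` is the identity. -/
theorem stratified_stmt7 (X : Type*) [TopologicalSpace X]
    (hfin : (irreducibleComponents X).Finite)
    (U : Set X) (hUopen : IsOpen U) (hUdense : Dense U)
    (f : U → X) (hf : Continuous f) (hfdense : Dense (Set.range f)) :
    ∃ σ : Equiv.Perm (irreducibleComponents X),
      (∀ C : irreducibleComponents X,
        closure (f '' {x : U | (x : X) ∈ (C : Set X)}) = ((σ C : Set X))) ∧
      ∃ n : ℕ, 0 < n ∧ σ ^ n = 1 := by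
  have : Finite (irreducibleComponents X) := hfin
  have hirr (C : irreducibleComponents X) : IsIrreducible (f '' {x : U | (x : X) ∈ (C : Set X)}) :=
    C.2.1.image_preimage_val hUopen
      (hUdense.inter_nonempty_of_mem_irreducibleComponents hfin C.2) hf
  have hdense : Dense (⋃ C : irreducibleComponents X, f '' {x : U | (x : X) ∈ (C : Set X)}) := by
    refine hfdense.mono ?_
    rintro _ ⟨x, rfl⟩
    exact Set.mem_iUnion.mpr ⟨⟨_, irreducibleComponent_mem_irreducibleComponents (x : X)⟩,
      x, mem_irreducibleComponent, rfl⟩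
  choose g hg using fun Z : irreducibleComponents X ↦
    exists_closure_eq_of_mem_irreducibleComponents hirr hdense Z.2
  have hinj : Function.Injective g := fun Z W h ↦ Subtype.ext <| by rw [← hg Z, ← hg W, h]
  let τ : Equiv.Perm (irreducibleComponents X) :=
    Equiv.ofBijective g (Finite.injective_iff_bijective.mp hinj)
  refine ⟨τ.symm, fun C ↦ ?_, ?_⟩
  · rw [← hg (τ.symm C), show g (τ.symm C) = C from τ.apply_symm_apply C]
  · exact isOfFinOrder_iff_pow_eq_one.mp (isOfFinOrder_of_finite τ.symm)
end
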